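/- The graph F(8,13,9), defined as the simple graph on vertex set {1,...,8} with edge set {{4,6},{1,4},{1,2},{2,3},{3,6},{5,6},{1,3},{4,5},{2,8},{2,7},{7,8},{3,8},{5,7}}, is forbidden: there is no injective map φ : {1,...,8} → ℝ² with dist(φ(i), φ(j)) = 1 for every edge {i,j}. -/

import Mathlib

lemma dist_one_coord (p q : EuclideanSpace ℝ (Fin 2)) (h : dist p q = 1) :
    (p 0 - q 0) ^ 2 + (p 1 - q 1) ^ 2 = 1 := by
  rw [EuclideanSpace.dist_eq, Real.sqrt_eq_one] at h
  simpa [Fin.sum_univ_two, Real.dist_eq, sq_abs] using h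

lemma coord_ne (p q : EuclideanSpace ℝ (Fin 2)) (h : p ≠ q) :
    ¬ (p 0 = q 0 ∧ p 1 = q 1) := by
  rintro ⟨h0, h1⟩
  apply h
  ext i
  fin_cases i
  · exact h0
  · exact h1

lemma perp_zero (x y z w : ℝ) (h : ¬ (x = 0 ∧ y = 0)) (h1 : x * z + y * w = 0)
    (h2 : x * w - y * z = 0) : z = 0 ∧ w = 0 := by
  have hp : x ^ 2 + y ^ 2 ≠ 0 := by
    intro h0
    exact h ⟨by nlinarith [sq_nonneg x, sq_nonneg y], by nlinarith [sq_nonneg x, sq_nonneg y]⟩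
  constructor
  · apply (mul_eq_zero.mp (?_ : (x ^ 2 + y ^ 2) * z = 0)).resolve_left hp
    linear_combination x * h1 - y * h2
  · apply (mul_eq_zero.mp (?_ : (x ^ 2 + y ^ 2) * w = 0)).resolve_left hp
    linear_combination y * h1 + x * h2

/-- Four unit distances forming a 4-cycle `a p b q` with distinct opposite vertices: a rhombus. -/
lemma rhombus (a a' b b' p p' q q' : ℝ)
    (hab : ¬ (a = b ∧ a' = b')) (hpq : ¬ (p = q ∧ p' = q'))
    (h1 : (a - p) ^ 2 + (a' - p') ^ 2 = 1) (h2 : (b - p) ^ 2 + (b' - p') ^ 2 = 1)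
    (h3 : (a - q) ^ 2 + (a' - q') ^ 2 = 1) (h4 : (b - q) ^ 2 + (b' - q') ^ 2 = 1) :
    p + q = a + b ∧ p' + q' = a' + b' := by
  have hab' : ¬ (a - b = 0 ∧ a' - b' = 0) := by simpa [sub_eq_zero] using hab
  have e1 : (a - b) * (p - q) + (a' - b') * (p' - q') = 0 := by
    linear_combination (-h1 + h2 + h3 - h4) / 2
  have e2 : (a - b) * (p + q - a - b) + (a' - b') * (p' + q' - a' - b') = 0 := by
    linear_combination (-h1 + h2 - h3 + h4) / 2
  have e3 : (p - q) * (p + q - a - b) + (p' - q') * (p' + q' - a' - b') = 0 := by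
    linear_combination (h1 + h2 - h3 - h4) / 2
  by_cases hw : p + q - a - b = 0 ∧ p' + q' - a' - b' = 0
  · exact ⟨by linarith [hw.1], by linarith [hw.2]⟩
  · exfalso
    apply hpq
    have hc : (a - b) * (p' - q') - (a' - b') * (p - q) = 0 := by
      by_contra hne
      apply hw
      constructor
      · apply (mul_eq_zero.mp (?_ : _ * (p + q - a - b) = 0)).resolve_left hne
        linear_combination (p' - q') * e2 - (a' - b') * e3
      · apply (mul_eq_zero.mp (?_ : _ * (p' + q' - a' - b') = 0)).resolve_left hne
        linear_combination (a - b) * e3 - (p - q) * e2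
    have := perp_zero _ _ _ _ hab' e1 hc
    exact ⟨by linarith [this.1], by linarith [this.2]⟩

theorem F_8_13_9_forbidden :
    ¬ ∃ φ : ℕ → EuclideanSpace ℝ (Fin 2),
      Set.InjOn φ (Set.Icc 1 8) ∧
      dist (φ 4) (φ 6) = 1 ∧
      dist (φ 1) (φ 4) = 1 ∧
      dist (φ 1) (φ 2) = 1 ∧
      dist (φ 2) (φ 3) = 1 ∧
      dist (φ 3) (φ 6) = 1 ∧
      dist (φ 5) (φ 6) = 1 ∧
      dist (φ 1) (φ 3) = 1 ∧
      dist (φ 4) (φ 5) = 1 ∧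
      dist (φ 2) (φ 8) = 1 ∧
      dist (φ 2) (φ 7) = 1 ∧
      dist (φ 7) (φ 8) = 1 ∧
      dist (φ 3) (φ 8) = 1 ∧
      dist (φ 5) (φ 7) = 1 := by
  rintro ⟨φ, hinj, h46, h14, h12, h23, h36, h56, h13, h45, h28, h27, h78, h38, h57⟩
  have ne : ∀ i j : ℕ, 1 ≤ i → i ≤ 8 → 1 ≤ j → j ≤ 8 → i ≠ j →
      ¬ (φ i 0 = φ j 0 ∧ φ i 1 = φ j 1) := fun i j a b c d hij =>
    coord_ne _ _ fun h => hij (hinj ⟨a, b⟩ ⟨c, d⟩ h)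
  have n18 := ne 1 8 (by norm_num) (by norm_num) (by norm_num) (by norm_num) (by norm_num)
  have n23 := ne 2 3 (by norm_num) (by norm_num) (by norm_num) (by norm_num) (by norm_num)
  have n28 := ne 2 8 (by norm_num) (by norm_num) (by norm_num) (by norm_num) (by norm_num)
  have n37 := ne 3 7 (by norm_num) (by norm_num) (by norm_num) (by norm_num) (by norm_num)
  have n16 := ne 1 6 (by norm_num) (by norm_num) (by norm_num) (by norm_num) (by norm_num)
  have n34 := ne 3 4 (by norm_num) (by norm_num) (by norm_num) (by norm_num) (by norm_num)
  have n46 := ne 4 6 (by norm_num) (by norm_num) (by norm_num) (by norm_num) (by norm_num)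
  have n27 := ne 2 7 (by norm_num) (by norm_num) (by norm_num) (by norm_num) (by norm_num)
  have n58 := ne 5 8 (by norm_num) (by norm_num) (by norm_num) (by norm_num) (by norm_num)
  have n62 := ne 6 2 (by norm_num) (by norm_num) (by norm_num) (by norm_num) (by norm_num)
  replace h46 := dist_one_coord _ _ h46
  replace h14 := dist_one_coord _ _ h14
  replace h12 := dist_one_coord _ _ h12
  replace h23 := dist_one_coord _ _ h23
  replace h36 := dist_one_coord _ _ h36
  replace h56 := dist_one_coord _ _ h56
  replace h13 := dist_one_coord _ _ h13
  replace h45 := dist_one_coord _ _ h45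
  replace h28 := dist_one_coord _ _ h28
  replace h27 := dist_one_coord _ _ h27
  replace h78 := dist_one_coord _ _ h78
  replace h38 := dist_one_coord _ _ h38
  replace h57 := dist_one_coord _ _ h57
  clear ne hinj
  generalize φ 1 0 = x1 at *
  generalize φ 1 1 = y1 at *
  generalize φ 2 0 = x2 at *
  generalize φ 2 1 = y2 at *
  generalize φ 3 0 = x3 at *
  generalize φ 3 1 = y3 at *
  generalize φ 4 0 = x4 at *
  generalize φ 4 1 = y4 at *
  generalize φ 5 0 = x5 at *
  generalize φ 5 1 = y5 at *
  generalize φ 6 0 = x6 at *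
  generalize φ 6 1 = y6 at *
  generalize φ 7 0 = x7 at *
  generalize φ 7 1 = y7 at *
  generalize φ 8 0 = x8 at *
  generalize φ 8 1 = y8 at *
  obtain ⟨a1, b1⟩ := rhombus x2 y2 x3 y3 x1 y1 x8 y8 n23 n18
    (by linarith) (by linarith) (by linarith) (by linarith)
  obtain ⟨a2, b2⟩ := rhombus x2 y2 x8 y8 x3 y3 x7 y7 n28 n37
    (by linarith) (by linarith) (by linarith) (by linarith)
  obtain ⟨a3, b3⟩ := rhombus x1 y1 x6 y6 x3 y3 x4 y4 n16 n34
    (by linarith) (by linarith) (by linarith) (by linarith)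
  obtain rfl : x8 = x2 + x3 - x1 := by linarith
  obtain rfl : y8 = y2 + y3 - y1 := by linarith
  obtain rfl : x7 = 2 * x2 - x1 := by linarith
  obtain rfl : y7 = 2 * y2 - y1 := by linarith
  obtain rfl : x4 = x1 + x6 - x3 := by linarith
  obtain rfl : y4 = y1 + y6 - y3 := by linarith
  by_cases h5 : x5 = x6 + x2 - x3 ∧ y5 = y6 + y2 - y3
  · obtain ⟨rfl, rfl⟩ := h5
    obtain ⟨a4, b4⟩ := rhombus _ _ _ _ _ _ _ _ n27 n58
      (by linarith) (by linarith) (by linarith) (by linarith)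
    exact n62 ⟨by linarith, by linarith⟩
  · obtain ⟨a4, b4⟩ := rhombus _ _ _ _ _ _ _ _ n46 h5
      (by linarith) (by linarith) (by linarith) (by linarith)
    obtain rfl : x5 = x1 + x6 - x2 := by linarith
    obtain rfl : y5 = y1 + y6 - y2 := by linarith
    nlinarith [sq_nonneg ((x6 - x3) + (x3 - x2 + 2 * (x1 - x2)) / 2),
      sq_nonneg ((y6 - y3) + (y3 - y2 + 2 * (y1 - y2)) / 2)]
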